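/- Let S be a finite meet-semilattice with least element 0 and greatest element 1 of order n ≥ 3 in which every element other than 0 and 1 is simultaneously an atom and a coatom (the fan semilattice F_n). Then for every m ≥ 1 the number of inconsistent equations in at most m variables over S equals (2^m − 1)·(n² − 3n + 3). -/

import Mathlib

/-- An equation of the first kind in at most `m` variables over a meet-semilattice `S`:
`(⊓_{i ∈ T} x_i) ⊓ s₁ = (⊓_{i ∈ U} x_i) ⊓ s₂` with `T, U` nonempty. -/
structure EqFst (S : Type*) (m : ℕ) where
  T : Finset (Fin m)
  hT : T.Nonempty
  s₁ : S
  U : Finset (Fin m)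
  hU : U.Nonempty
  s₂ : S

/-- An equation of the second kind: `(⊓_{i ∈ T} x_i) ⊓ s₁ = s₂` with `T` nonempty. -/
structure EqSnd (S : Type*) (m : ℕ) where
  T : Finset (Fin m)
  hT : T.Nonempty
  s₁ : S
  s₂ : S

def EqFst.HasSolution {S : Type*} [SemilatticeInf S] {m : ℕ} (e : EqFst S m) : Prop :=
  ∃ v : Fin m → S, (e.T.inf' e.hT v) ⊓ e.s₁ = (e.U.inf' e.hU v) ⊓ e.s₂

def EqSnd.HasSolution {S : Type*} [SemilatticeInf S] {m : ℕ} (e : EqSnd S m) : Prop :=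
  ∃ v : Fin m → S, (e.T.inf' e.hT v) ⊓ e.s₁ = e.s₂

/-- The number of inconsistent equations (of both kinds) in at most `m` variables over `S`. -/
noncomputable def numInconsistent (S : Type*) [SemilatticeInf S] (m : ℕ) : ℕ :=
  Nat.card {e : EqFst S m // ¬ e.HasSolution} + Nat.card {e : EqSnd S m // ¬ e.HasSolution}

theorem EqFst.hasSolution {S : Type*} [SemilatticeInf S] [OrderBot S] {m : ℕ} (e : EqFst S m) :
    e.HasSolution :=
  ⟨fun _ => ⊥, by simp [Finset.inf'_const]⟩

theorem EqSnd.hasSolution_iff {S : Type*} [SemilatticeInf S] {m : ℕ} (e : EqSnd S m) :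
    e.HasSolution ↔ e.s₂ ≤ e.s₁ := by
  constructor
  · rintro ⟨v, hv⟩
    exact hv ▸ inf_le_right
  · intro h
    exact ⟨fun _ => e.s₂, by simpa [Finset.inf'_const] using h⟩

/-- Inconsistent equations of the second kind correspond to a nonempty set of variables together
with a pair of constants `(s₁, s₂)` such that `¬ s₂ ≤ s₁`. -/
def EqSnd.inconsistentEquiv (S : Type*) [SemilatticeInf S] (m : ℕ) :
    {e : EqSnd S m // ¬ e.HasSolution} ≃
      {T : Finset (Fin m) // T.Nonempty} × {p : S × S // ¬ p.2 ≤ p.1} where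
  toFun e := (⟨e.1.T, e.1.hT⟩, ⟨(e.1.s₁, e.1.s₂), fun h => e.2 (e.1.hasSolution_iff.2 h)⟩)
  invFun q := ⟨⟨q.1.1, q.1.2, q.2.1.1, q.2.1.2⟩, fun h => q.2.2 ((EqSnd.hasSolution_iff _).1 h)⟩
  left_inv _ := rfl
  right_inv _ := rfl

theorem card_nonempty_finset_fin (m : ℕ) :
    Nat.card {T : Finset (Fin m) // T.Nonempty} = 2 ^ m - 1 := by
  classical
  have h := Fintype.card_subtype_compl (fun T : Finset (Fin m) => T = ∅)
  simp only [← Finset.nonempty_iff_ne_empty, ← ne_eq, Fintype.card_subtype_eq,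
    Fintype.card_finset, Fintype.card_fin] at h
  rw [Nat.card_eq_fintype_card, ← h]

open Classical in
theorem card_filter_le_fan {S : Type*} [Fintype S] [SemilatticeInf S] [OrderBot S] [OrderTop S]
    (hn : 3 ≤ Fintype.card S) (hfan : ∀ s : S, s ≠ ⊥ → s ≠ ⊤ → IsAtom s) (s : S) :
    (Finset.univ.filter (· ≤ s)).card + (if s = ⊥ then 1 else 0) =
      2 + if s = ⊤ then Fintype.card S - 2 else 0 := by
  have hbt : (⊥ : S) ≠ ⊤ := by
    intro h
    have : Subsingleton S :=
      ⟨fun a b => (le_top.trans (h ▸ bot_le)).antisymm (le_top.trans (h ▸ bot_le))⟩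
    have := Fintype.card_le_one_iff_subsingleton.2 this
    omega
  by_cases hb : s = ⊥
  · subst hb
    have h : Finset.univ.filter (· ≤ (⊥ : S)) = {⊥} := by
      ext t
      simp
    rw [h, Finset.card_singleton, if_pos rfl, if_neg hbt]
  by_cases ht : s = ⊤
  · subst ht
    simp only [le_top, Finset.filter_true, Finset.card_univ, hbt.symm, if_true, if_false]
    omega
  have h : Finset.univ.filter (· ≤ s) = {⊥, s} := by
    ext t
    simp [(hfan s hb ht).le_iff]
  rw [h, Finset.card_pair (Ne.symm hb), if_neg hb, if_neg ht]

theorem card_le_pairs_fan {S : Type*} [Fintype S] [SemilatticeInf S] [OrderBot S] [OrderTop S]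
    (hn : 3 ≤ Fintype.card S) (hfan : ∀ s : S, s ≠ ⊥ → s ≠ ⊤ → IsAtom s) :
    Nat.card {p : S × S // p.2 ≤ p.1} = 3 * Fintype.card S - 3 := by
  classical
  have hsum := Finset.sum_congr (rfl : (Finset.univ : Finset S) = Finset.univ)
    (fun s _ => card_filter_le_fan hn hfan s)
  simp only [Finset.sum_add_distrib, Finset.sum_ite_eq', Finset.mem_univ, if_true,
    Finset.sum_const, Finset.card_univ, smul_eq_mul] at hsum
  rw [Nat.card_congr (Equiv.subtypeProdEquivSigmaSubtype (fun s t : S => t ≤ s)),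
    Nat.card_eq_fintype_card, Fintype.card_sigma]
  simp only [Fintype.card_subtype]
  omega

theorem card_not_le_pairs_fan {S : Type*} [Fintype S] [SemilatticeInf S] [OrderBot S] [OrderTop S]
    (hn : 3 ≤ Fintype.card S) (hfan : ∀ s : S, s ≠ ⊥ → s ≠ ⊤ → IsAtom s) :
    Nat.card {p : S × S // ¬ p.2 ≤ p.1} = Fintype.card S ^ 2 - 3 * Fintype.card S + 3 := by
  classical
  have h := card_le_pairs_fan hn hfan
  rw [Nat.card_eq_fintype_card] at h
  rw [Nat.card_eq_fintype_card, Fintype.card_subtype_compl, h, Fintype.card_prod, ← sq]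
  have : 3 * Fintype.card S ≤ Fintype.card S ^ 2 := by nlinarith
  omega

/-- If every element of `S` other than `⊥` and `⊤` is both an atom and a coatom
(the fan semilattice `F_n`), then the number of inconsistent equations in at most
`m` variables equals `(2^m − 1)(n² − 3n + 3)`. -/
theorem stmt_3 (S : Type*) [Fintype S] [SemilatticeInf S] [OrderBot S] [OrderTop S]
    (hn : 3 ≤ Fintype.card S)
    (hfan : ∀ s : S, s ≠ ⊥ → s ≠ ⊤ → IsAtom s ∧ IsCoatom s)
    (m : ℕ) (hm : 1 ≤ m) :
    numInconsistent S m =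
      (2 ^ m - 1) * (Fintype.card S ^ 2 - 3 * Fintype.card S + 3) := by
  have : IsEmpty {e : EqFst S m // ¬ e.HasSolution} := ⟨fun e => e.2 e.1.hasSolution⟩
  rw [numInconsistent, Nat.card_of_isEmpty, zero_add,
    Nat.card_congr (EqSnd.inconsistentEquiv S m), Nat.card_prod, card_nonempty_finset_fin,
    card_not_le_pairs_fan hn fun s hb ht => (hfan s hb ht).1]
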